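/- arXiv:1302.2112 — 2 statements merged into one kernel-verified Lean document; each statement's English description precedes it below -/
import Mathlib

section
/- Let p_1, …, p_n be pairwise distinct primes, let p be a prime with p > ∏_{i=1}^n p_i, let g be an element of (ℤ/pℤ)ˣ, let x, k be natural numbers, and set y = g^x, s_i = g^k, and u_i = y^k · p_i in (ℤ/pℤ)ˣ (assuming p does not divide any p_i). Then the map sending r = (r_1, …, r_n) ∈ {0,1}^n to the pair (∏_{i=1}^n s_i^{r_i}, ∏_{i=1}^n u_i^{r_i}) in (ℤ/pℤ)ˣ × (ℤ/pℤ)ˣ is injective. -/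
theorem factorization_prod_pow_of_injective {ι : Type*} [Fintype ι] {q : ι → ℕ}
    (hq : ∀ i, (q i).Prime) (hinj : Function.Injective q) (e : ι → ℕ) (i : ι) :
    (∏ j, q j ^ e j).factorization (q i) = e i := by
  rw [Nat.factorization_prod fun j _ => pow_ne_zero _ (hq j).ne_zero, Finset.sum_apply',
    Finset.sum_eq_single i]
  · simp [(hq i).factorization]
  · intro j _ hji
    simp [(hq j).factorization, hinj.ne hji]
  · simp

theorem prod_pow_le_prod_of_le_one {ι : Type*} [Fintype ι] {q e : ι → ℕ}
    (hq : ∀ i, 0 < q i) (he : ∀ i, e i ≤ 1) : ∏ i, q i ^ e i ≤ ∏ i, q i :=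
  Finset.prod_le_prod' fun i _ => by simpa using Nat.pow_le_pow_right (hq i) (he i)


/-- Injectivity of the randomness map in the modified cryptosystem (used in Case 2
of Theorem 5.4): with pairwise distinct primes `pᵢ`, a prime `p > ∏ pᵢ` not dividing
any `pᵢ` (with `P i` the unit of `ℤ/pℤ` corresponding to `pᵢ`), `y = g^x`,
`sᵢ = g^k` and `uᵢ = y^k · pᵢ` in `(ℤ/pℤ)ˣ`, the map
`r ↦ (∏ sᵢ^{rᵢ}, ∏ uᵢ^{rᵢ})` is injective on `{0,1}^n`. -/
theorem modified_scheme_randomness_injective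
    (n : ℕ) (pr : Fin n → ℕ) (hpr : ∀ i, (pr i).Prime)
    (hdist : ∀ i j, i ≠ j → pr i ≠ pr j)
    (p : ℕ) [Fact p.Prime] (hbig : ∏ i, pr i < p)
    (hnd : ∀ i, ¬ p ∣ pr i)
    (P : Fin n → (ZMod p)ˣ) (hP : ∀ i, (P i : ZMod p) = (pr i : ZMod p))
    (g : (ZMod p)ˣ) (x k : ℕ) (y : (ZMod p)ˣ) (hy : y = g ^ x)
    (s u : Fin n → (ZMod p)ˣ)
    (hs : ∀ i, s i = g ^ k) (hu : ∀ i, u i = y ^ k * P i)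
    (r r' : Fin n → ℕ) (hr : ∀ i, r i = 0 ∨ r i = 1) (hr' : ∀ i, r' i = 0 ∨ r' i = 1)
    (heq : (∏ i, s i ^ r i, ∏ i, u i ^ r i) = (∏ i, s i ^ r' i, ∏ i, u i ^ r' i)) :
    r = r' := by
  have hinj : Function.Injective pr := fun i j h => by_contra fun hij => hdist i j hij h
  obtain ⟨h₁, h₂⟩ := Prod.mk.inj heq
  simp only [hs, Finset.prod_pow_eq_pow_sum] at h₁
  simp only [hu, mul_pow, Finset.prod_mul_distrib, Finset.prod_pow_eq_pow_sum] at h₂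
  have hy_pow (m : ℕ) : (y ^ k) ^ m = ((g ^ k) ^ m) ^ x := by
    simp only [hy, ← pow_mul]
    congr 1
    ring
  rw [hy_pow, hy_pow, h₁] at h₂
  have hcast : ((∏ i, pr i ^ r i : ℕ) : ZMod p) = ((∏ i, pr i ^ r' i : ℕ) : ZMod p) := by
    simpa [hP] using congrArg (Units.val : (ZMod p)ˣ → ZMod p) (mul_left_cancel h₂)
  have hlt (e : Fin n → ℕ) (he : ∀ i, e i = 0 ∨ e i = 1) : ∏ i, pr i ^ e i < p :=
    (prod_pow_le_prod_of_le_one (fun i => (hpr i).pos) fun i => by grind).trans_lt hbig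
  have hnat : ∏ i, pr i ^ r i = ∏ i, pr i ^ r' i :=
    ((ZMod.natCast_eq_natCast_iff _ _ _).1 hcast).eq_of_lt_of_lt (hlt r hr) (hlt r' hr')
  funext i
  rw [← factorization_prod_pow_of_injective hpr hinj r i, hnat,
    factorization_prod_pow_of_injective hpr hinj]
end

section
/- Let q be a prime and p = 2q + 1 a safe prime. Let r' be an odd integer with 0 < r' < q, let h be a natural number, let w be a natural number with w·r' ≡ 1 (mod p − 1), and let m be an integer with 0 < m + h < p. Set C_2 = (m + h)^{r'} mod p. Then (C_2^w mod p) − h = m; i.e., the decryption steps (e)–(f) of the modified cryptosystem recover the message m exactly. -/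
/-- Over a prime modulus, raising to an exponent congruent to `1` modulo `p - 1` fixes every
integer in the open interval from `0` to `p`. -/
theorem Int.pow_emod_eq_self_of_modEq_one {p : ℕ} (hp : p.Prime) {k : ℕ}
    (hk : k ≡ 1 [MOD p - 1]) {a : ℤ} (h0 : 0 < a) (hlt : a < p) : a ^ k % p = a := by
  have := Fact.mk hp
  have ha : (a : ZMod p) ≠ 0 := fun h ↦
    (Int.le_of_dvd h0 ((ZMod.intCast_zmod_eq_zero_iff_dvd a p).1 h)).not_gt hlt
  have hpow : (a : ZMod p) ^ k = a := by
    simpa using pow_eq_pow_of_modEq hk (ZMod.pow_card_sub_one_eq_one ha)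
  have hmod : a ^ k ≡ a [ZMOD p] := by
    rw [← ZMod.intCast_eq_intCast_iff]
    exact_mod_cast hpow
  exact hmod.eq.trans (Int.emod_eq_of_lt h0.le hlt)

/-- Completeness of the message-recovery phase (decryption steps (e)–(f)) of the
modified cryptosystem: for a safe prime `p = 2q + 1`, an odd exponent `r'` with
`0 < r' < q`, a Hamming weight `h`, a `w` with `w·r' ≡ 1 (mod p − 1)`, and a message
`m` with `0 < m + h < p`, setting `C₂ = (m + h)^{r'} mod p` we recover
`(C₂^w mod p) − h = m`. -/
theorem modified_scheme_message_recovery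
    (q : ℕ) (hq : q.Prime) (p : ℕ) (hp : p = 2 * q + 1) (hpp : p.Prime)
    (r' : ℕ) (hodd : Odd r') (hr0 : 0 < r') (hrq : r' < q)
    (h : ℕ) (w : ℕ) (hw : w * r' ≡ 1 [MOD p - 1])
    (m : ℤ) (hm0 : 0 < m + h) (hmp : m + h < p)
    (C2 : ℤ) (hC2 : C2 = (m + h) ^ r' % p) :
    C2 ^ w % p - h = m := by
  have hpow : C2 ^ w ≡ (m + h) ^ (w * r') [ZMOD p] := by
    rw [hC2, mul_comm w, pow_mul]
    exact (Int.mod_modEq _ _).pow w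
  rw [hpow.eq, Int.pow_emod_eq_self_of_modEq_one hpp hw hm0 hmp, add_sub_cancel_right]
end
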